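/- Under the pre-treatment factor model with Γα = β, the contaminated surrogate model with ΓΨ = Θ, and the contaminated treatment-effect model with Φγ = θ, the mean of the treated potential outcome is identified: E[Y1] = E[⟪W, α⟫ + ⟪X1 − Ψᵀ W, γ⟫]. -/

import Mathlib

open MeasureTheory Matrix

theorem integral_eq_zero_of_condExp_ae_eq_zero {Ω : Type*} {m m0 : MeasurableSpace Ω}
    {μ : Measure Ω} [IsFiniteMeasure μ] (hm : m ≤ m0) {f : Ω → ℝ} (h : μ[f | m] =ᵐ[μ] 0) :
    ∫ ω, f ω ∂μ = 0 := by
  rw [← integral_condExp hm, integral_congr_ae h]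
  simp

theorem integrable_dotProduct_const {Ω ι : Type*} [Fintype ι] [MeasurableSpace Ω]
    {μ : Measure Ω} {f : Ω → ι → ℝ} (hf : ∀ i, Integrable (fun ω => f ω i) μ) (c : ι → ℝ) :
    Integrable (fun ω => f ω ⬝ᵥ c) μ :=
  integrable_finsetSum _ fun i _ => (hf i).mul_const (c i)

theorem integral_dotProduct_const_eq_zero {Ω ι : Type*} [Fintype ι] [MeasurableSpace Ω]
    {μ : Measure Ω} {f : Ω → ι → ℝ} (hf : ∀ i, Integrable (fun ω => f ω i) μ)
    (h : ∀ i, ∫ ω, f ω i ∂μ = 0) (c : ι → ℝ) :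
    ∫ ω, f ω ⬝ᵥ c ∂μ = 0 := by
  simp only [dotProduct]
  rw [integral_finsetSum _ fun i _ => (hf i).mul_const (c i)]
  simp [integral_mul_const, h]

/-- Under the pre-treatment factor model with Γα = β, the contaminated surrogate
model with ΓΨ = Θ, and the contaminated treatment-effect model with Φγ = θ, the mean of the
treated potential outcome is identified: E[Y1] = E[⟪W, α⟫ + ⟪X1 − Ψᵀ W, γ⟫]. -/
theorem sc_identification_Y1_contaminated
    {Ω : Type*} [MeasurableSpace Ω] (P : Measure Ω) [IsProbabilityMeasure P]
    {F N K H : ℕ}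
    (lam : Ω → Fin F → ℝ) (β : Fin F → ℝ) (Γ : Matrix (Fin F) (Fin N) ℝ)
    (rho : Ω → Fin K → ℝ) (θ : Fin K → ℝ) (Φ : Matrix (Fin K) (Fin H) ℝ)
    (Θ : Matrix (Fin F) (Fin H) ℝ) (Ψ : Matrix (Fin N) (Fin H) ℝ)
    (Y0 Y1 : Ω → ℝ) (W : Ω → Fin N → ℝ) (X0 X1 : Ω → Fin H → ℝ)
    (εY : Ω → ℝ) (εW : Ω → Fin N → ℝ) (εX : Ω → Fin H → ℝ)
    (δ : Ω → ℝ) (δX : Ω → Fin H → ℝ)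
    (hlam : Measurable lam) (hrho : Measurable rho)
    (hY0 : ∀ ω, Y0 ω = lam ω ⬝ᵥ β + εY ω)
    (hW : ∀ ω, W ω = Γ.transpose.mulVec (lam ω) + εW ω)
    (hX0 : ∀ ω, X0 ω = Θ.transpose.mulVec (lam ω) + εX ω)
    (hY1 : ∀ ω, Y1 ω - Y0 ω = rho ω ⬝ᵥ θ + δ ω)
    (hX1 : ∀ ω, X1 ω - X0 ω = Φ.transpose.mulVec (rho ω) + δX ω)
    (hεY : P[εY | MeasurableSpace.comap lam inferInstance] =ᵐ[P] 0)
    (hεW : ∀ i, P[(fun ω => εW ω i) | MeasurableSpace.comap lam inferInstance] =ᵐ[P] 0)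
    (hεX : ∀ j, P[(fun ω => εX ω j) | MeasurableSpace.comap lam inferInstance] =ᵐ[P] 0)
    (hδ : P[δ | MeasurableSpace.comap (fun ω => (lam ω, rho ω)) inferInstance] =ᵐ[P] 0)
    (hδX : ∀ j, P[(fun ω => δX ω j) |
      MeasurableSpace.comap (fun ω => (lam ω, rho ω)) inferInstance] =ᵐ[P] 0)
    (hY0int : Integrable Y0 P) (hY1int : Integrable Y1 P)
    (hεYint : Integrable εY P) (hδint : Integrable δ P)
    (hlamint : ∀ i, Integrable (fun ω => lam ω i) P)
    (hrhoint : ∀ i, Integrable (fun ω => rho ω i) P)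
    (hWint : ∀ i, Integrable (fun ω => W ω i) P)
    (hX0int : ∀ j, Integrable (fun ω => X0 ω j) P)
    (hX1int : ∀ j, Integrable (fun ω => X1 ω j) P)
    (hεWint : ∀ i, Integrable (fun ω => εW ω i) P)
    (hεXint : ∀ j, Integrable (fun ω => εX ω j) P)
    (hδXint : ∀ j, Integrable (fun ω => δX ω j) P)
    (α : Fin N → ℝ) (hα : Γ.mulVec α = β)
    (hΨ : Γ * Ψ = Θ)
    (γ : Fin H → ℝ) (hγ : Φ.mulVec γ = θ) :
    ∫ ω, Y1 ω ∂P
      = ∫ ω, (W ω ⬝ᵥ α + (X1 ω - Ψ.transpose.mulVec (W ω)) ⬝ᵥ γ) ∂P := by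
  have hlam_le := hlam.comap_le
  have hpair_le := (hlam.prodMk hrho).comap_le
  have hpoint : ∀ ω, W ω ⬝ᵥ α + (X1 ω - Ψ.transpose.mulVec (W ω)) ⬝ᵥ γ
      = Y1 ω + (εW ω ⬝ᵥ (α - Ψ.mulVec γ) + (εX ω ⬝ᵥ γ + δX ω ⬝ᵥ γ) - (εY ω + δ ω)) := by
    intro ω
    have hX : X1 ω = Θ.transpose.mulVec (lam ω) + εX ω
        + (Φ.transpose.mulVec (rho ω) + δX ω) := by
      rw [← hX0, ← hX1]; abel
    have hY : Y1 ω = lam ω ⬝ᵥ β + εY ω + (rho ω ⬝ᵥ θ + δ ω) := by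
      rw [← hY0, ← hY1]; ring
    rw [hX, hY, hW, ← hα, ← hγ, ← hΨ]
    simp only [mulVec_transpose, add_dotProduct, sub_dotProduct, dotProduct_sub, add_vecMul,
      ← dotProduct_mulVec, ← mulVec_mulVec]
    ring
  have hW_int := integrable_dotProduct_const hεWint (α - Ψ.mulVec γ)
  have hX_int := integrable_dotProduct_const hεXint γ
  have hδX_int := integrable_dotProduct_const hδXint γ
  have hW_zero := integral_dotProduct_const_eq_zero hεWint
    (fun i => integral_eq_zero_of_condExp_ae_eq_zero hlam_le (hεW i)) (α - Ψ.mulVec γ)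
  have hX_zero := integral_dotProduct_const_eq_zero hεXint
    (fun j => integral_eq_zero_of_condExp_ae_eq_zero hlam_le (hεX j)) γ
  have hδX_zero := integral_dotProduct_const_eq_zero hδXint
    (fun j => integral_eq_zero_of_condExp_ae_eq_zero hpair_le (hδX j)) γ
  simp_rw [hpoint]
  rw [integral_add hY1int (by fun_prop), integral_sub (by fun_prop) (by fun_prop),
    integral_add hW_int (by fun_prop), integral_add hX_int hδX_int,
    integral_add hεYint hδint, hW_zero, hX_zero, hδX_zero,
    integral_eq_zero_of_condExp_ae_eq_zero hlam_le hεY,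
    integral_eq_zero_of_condExp_ae_eq_zero hpair_le hδ]
  simp
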